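/- Suppose each f_j (j ∈ H, |H| = h) is differentiable with L-Lipschitz gradient and μ-strongly convex, the average gradient at w* satisfies ‖(1/h)∑_{j∈H} ∇f_j(w*)‖² ≤ ξ². Let f(w) = (1/h)∑_{j∈H} f_j(w) and ∇f(w) its gradient. Then for any w and any ρ > 0: ‖∇f(w)‖² ≤ 4L(f(w) − f(w*)) + (2L/ρ)‖w − w*‖² + 2(1 + Lρ)ξ². -/

import Mathlib

open RealInnerProductSpace

section helpers

variable {E : Type*} [NormedAddCommGroup E] [InnerProductSpace ℝ E] [CompleteSpace E]

lemma line_deriv {F : E → ℝ} {G : E → E} (hg : ∀ x, HasGradientAt F (G x) x) (x v : E) (t : ℝ) :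
    HasDerivAt (fun s : ℝ => F (x + s • v)) (inner ℝ (G (x + t • v)) v) t := by
  have h1 : HasDerivAt (fun s : ℝ => x + s • v) v t := by
    simpa using ((hasDerivAt_id t).smul_const v).const_add x
  have h2 := (hg (x + t • v)).hasFDerivAt.comp_hasDerivAt t h1
  refine HasDerivAt.congr_deriv (f := fun s : ℝ => F (x + s • v)) h2 ?_
  simp

lemma descent {F : E → ℝ} {G : E → E} {L : ℝ} (hg : ∀ x, HasGradientAt F (G x) x)
    (hl : ∀ x y, ‖G x - G y‖ ≤ L * ‖x - y‖) (x v : E) :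
    F (x + v) ≤ F x + inner ℝ (G x) v + L / 2 * ‖v‖ ^ 2 := by
  have hd : ∀ t : ℝ, HasDerivAt
      (fun s : ℝ => F (x + s • v) - s * inner ℝ (G x) v - s ^ 2 * (L / 2 * ‖v‖ ^ 2))
      (inner ℝ (G (x + t • v)) v - inner ℝ (G x) v - t * L * ‖v‖ ^ 2) t := by
    intro t
    have h := ((line_deriv hg x v t).sub ((hasDerivAt_id t).mul_const (inner ℝ (G x) v))).sub
      ((hasDerivAt_pow 2 t).mul_const (L / 2 * ‖v‖ ^ 2))
    refine h.congr_deriv ?_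
    norm_num
    ring
  have hanti := antitoneOn_of_deriv_nonpos (convex_Icc (0 : ℝ) 1)
    (fun t _ => (hd t).continuousAt.continuousWithinAt)
    (fun t _ => (hd t).differentiableAt.differentiableWithinAt)
    (by
      intro t ht
      rw [interior_Icc] at ht
      rw [(hd t).deriv, ← inner_sub_left]
      have h1 := real_inner_le_norm (G (x + t • v) - G x) v
      have h2 := hl (x + t • v) x
      rw [add_sub_cancel_left, norm_smul, Real.norm_of_nonneg ht.1.le] at h2
      have h3 := mul_le_mul_of_nonneg_right h2 (norm_nonneg v)
      nlinarith)
  have h := hanti (Set.left_mem_Icc.2 zero_le_one) (Set.right_mem_Icc.2 zero_le_one) zero_le_one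
  simp at h
  linarith

lemma grad_ineq {F : E → ℝ} {G : E → E} (hg : ∀ x, HasGradientAt F (G x) x)
    (hc : ConvexOn ℝ Set.univ F) (x v : E) :
    F x + inner ℝ (G x) v ≤ F (x + v) := by
  have hc' : ConvexOn ℝ Set.univ (fun s : ℝ => F (x + s • v)) := by
    refine ⟨convex_univ, fun a _ b _ p q hp hq hpq => ?_⟩
    have h := hc.2 (Set.mem_univ (x + a • v)) (Set.mem_univ (x + b • v)) hp hq hpq
    have e : p • (x + a • v) + q • (x + b • v) = x + (p • a + q • b) • v := by
      have : x = (p + q) • x := by rw [hpq, one_smul]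
      conv_rhs => rw [this]
      simp only [smul_eq_mul]
      module
    rwa [e] at h
  have h := hc'.le_slope_of_hasDerivAt (Set.mem_univ 0) (Set.mem_univ 1) zero_lt_one
    (line_deriv hg x v 0)
  simp [slope_def_field] at h
  linarith

lemma cocoercive {F : E → ℝ} {G : E → E} {L : ℝ} (hL : 0 < L)
    (hg : ∀ x, HasGradientAt F (G x) x)
    (hc : ConvexOn ℝ Set.univ F)
    (hl : ∀ x y, ‖G x - G y‖ ≤ L * ‖x - y‖) (w s : E) :
    ‖G w - G s‖ ^ 2 ≤ 2 * L * (F w - F s - inner ℝ (G s) (w - s)) := by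
  have h1 := descent hg hl w (-(L⁻¹ • (G w - G s)))
  have h2 := grad_ineq hg hc s ((w - s) + -(L⁻¹ • (G w - G s)))
  rw [show s + ((w - s) + -(L⁻¹ • (G w - G s))) = w + -(L⁻¹ • (G w - G s)) by abel] at h2
  rw [inner_add_right] at h2
  have h3 : inner ℝ (G w) (G w - G s) - inner ℝ (G s) (G w - G s) = ‖G w - G s‖ ^ 2 := by
    rw [← inner_sub_left, real_inner_self_eq_norm_sq]
  rw [norm_neg, norm_smul, inner_neg_right, inner_smul_right, Real.norm_of_nonneg (by positivity)] at h1
  rw [inner_neg_right, inner_smul_right] at h2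
  have h4 : L⁻¹ * ‖G w - G s‖ ^ 2 - L / 2 * (L⁻¹ * ‖G w - G s‖) ^ 2
      ≤ F w - F s - inner ℝ (G s) (w - s) := by
    rw [← h3, mul_sub]
    linarith
  have h5 := mul_le_mul_of_nonneg_left h4 (by positivity : 0 ≤ 2 * L)
  refine le_trans (le_of_eq ?_) h5
  field_simp
  ring

lemma final_bound {F : E → ℝ} {G : E → E} {L ξ ρ : ℝ} (hL : 0 < L) (hρ : 0 < ρ)
    (hg : ∀ x, HasGradientAt F (G x) x)
    (hc : ConvexOn ℝ Set.univ F)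
    (hl : ∀ x y, ‖G x - G y‖ ≤ L * ‖x - y‖) (s : E) (hξ : ‖G s‖ ^ 2 ≤ ξ ^ 2) (w : E) :
    ‖G w‖ ^ 2 ≤ 4 * L * (F w - F s) + (2 * L / ρ) * ‖w - s‖ ^ 2 + 2 * (1 + L * ρ) * ξ ^ 2 := by
  have h1 := cocoercive hL hg hc hl w s
  have h2 : ‖G w‖ ^ 2 ≤ 2 * ‖G w - G s‖ ^ 2 + 2 * ‖G s‖ ^ 2 := by
    have h := norm_add_le (G w - G s) (G s)
    rw [sub_add_cancel] at h
    nlinarith [sq_nonneg (‖G w - G s‖ - ‖G s‖), norm_nonneg (G w)]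
  have h3 := (abs_le.1 (abs_real_inner_le_norm (G s) (w - s))).1
  have h4 : 2 * (‖G s‖ * ‖w - s‖) ≤ ρ * ‖G s‖ ^ 2 + ‖w - s‖ ^ 2 / ρ := by
    have : ρ * ‖G s‖ ^ 2 + ‖w - s‖ ^ 2 / ρ - 2 * (‖G s‖ * ‖w - s‖)
        = (ρ * ‖G s‖ - ‖w - s‖) ^ 2 / ρ := by
      field_simp
      ring
    have h0 : 0 ≤ (ρ * ‖G s‖ - ‖w - s‖) ^ 2 / ρ := by positivity
    linarith
  have h5 := mul_le_mul_of_nonneg_left hξ hρ.le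
  have h6 : -(2 * inner ℝ (G s) (w - s)) ≤ ρ * ξ ^ 2 + ‖w - s‖ ^ 2 / ρ := by linarith
  have h7 := mul_le_mul_of_nonneg_left h6 (by positivity : 0 ≤ 2 * L)
  have e : 2 * L / ρ * ‖w - s‖ ^ 2 = 2 * L * (‖w - s‖ ^ 2 / ρ) := by ring
  rw [e]
  linarith

end helpers

/-- Lemma 1: bound on the average honest gradient. -/
theorem stmt5 (d : ℕ) (ι : Type*) (H : Finset ι) (hH : H.Nonempty)
    (f : ι → EuclideanSpace ℝ (Fin d) → ℝ)
    (g : ι → EuclideanSpace ℝ (Fin d) → EuclideanSpace ℝ (Fin d))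
    (L ξ ρ : ℝ) (hL : 0 < L) (hρ : 0 < ρ)
    (hgrad : ∀ j ∈ H, ∀ x, HasGradientAt (f j) (g j x) x)
    (hconv : ∀ j ∈ H, ConvexOn ℝ Set.univ (f j))
    (hlip : ∀ j ∈ H, ∀ x y, ‖g j x - g j y‖ ≤ L * ‖x - y‖)
    (wstar : EuclideanSpace ℝ (Fin d))
    (hξ : ‖(H.card : ℝ)⁻¹ • ∑ j ∈ H, g j wstar‖ ^ 2 ≤ ξ ^ 2) :
    ∀ w, ‖(H.card : ℝ)⁻¹ • ∑ j ∈ H, g j w‖ ^ 2 ≤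
      4 * L * ((H.card : ℝ)⁻¹ * ∑ j ∈ H, f j w - (H.card : ℝ)⁻¹ * ∑ j ∈ H, f j wstar)
      + (2 * L / ρ) * ‖w - wstar‖ ^ 2 + 2 * (1 + L * ρ) * ξ ^ 2 := by
  have hn : (0 : ℝ) < H.card := by exact_mod_cast hH.card_pos
  refine final_bound (F := fun w => (H.card : ℝ)⁻¹ * ∑ j ∈ H, f j w)
    (G := fun w => (H.card : ℝ)⁻¹ • ∑ j ∈ H, g j w) hL hρ ?_ ?_ ?_ wstar hξ
  · intro x
    have h := (HasFDerivAt.fun_sum (fun j hj => (hgrad j hj x).hasFDerivAt)).const_mul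
      ((H.card : ℝ)⁻¹)
    rw [hasGradientAt_iff_hasFDerivAt]
    refine h.congr_fderiv ?_
    simp [map_sum]
  · refine ⟨convex_univ, fun x _ y _ p q hp hq hpq => ?_⟩
    have h : ∑ j ∈ H, f j (p • x + q • y) ≤ ∑ j ∈ H, (p * f j x + q * f j y) :=
      Finset.sum_le_sum fun j hj => (hconv j hj).2 (Set.mem_univ x) (Set.mem_univ y) hp hq hpq
    rw [Finset.sum_add_distrib, ← Finset.mul_sum, ← Finset.mul_sum] at h
    have h' := mul_le_mul_of_nonneg_left h (inv_nonneg.2 hn.le)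
    simp only [smul_eq_mul]
    linarith
  · intro x y
    rw [← smul_sub, ← Finset.sum_sub_distrib, norm_smul, Real.norm_of_nonneg (by positivity)]
    have h : ‖∑ j ∈ H, (g j x - g j y)‖ ≤ ∑ j ∈ H, L * ‖x - y‖ :=
      norm_sum_le_of_le _ fun j hj => hlip j hj x y
    rw [Finset.sum_const, nsmul_eq_mul] at h
    rw [inv_mul_le_iff₀ hn]
    exact h
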